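/- Let T be a strictly singular, injective bounded linear operator on an infinite dimensional Banach space X, let k be a positive integer, η > 0, and let F be a finite codimensional closed subspace of X. Then for every infinite dimensional closed subspace Y of X there exists an infinite dimensional closed subspace Z of Y such that for all z ∈ Z and all i = 1, ..., k+1 one has T^{i-1} z ∈ F and ‖T^i z‖ ≤ η ‖T^{i-1} z‖ (where T^0 denotes the identity operator on X). -/

import Mathlib

/-- A bounded linear operator `T` on a normed space `X` is strictly singular if for every
infinite dimensional closed subspace `Y` of `X`, the restriction of `T` to `Y` is not
bounded below. -/
def StrictlySingular {X : Type*} [NormedAddCommGroup X] [NormedSpace ℝ X]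
    (T : X →L[ℝ] X) : Prop :=
  ∀ Y : Submodule ℝ X, IsClosed (Y : Set X) → ¬ FiniteDimensional ℝ Y →
    ¬ ∃ c : ℝ, 0 < c ∧ ∀ y ∈ Y, c * ‖y‖ ≤ ‖T y‖

lemma aux_inter {X M : Type*} [AddCommGroup X] [Module ℝ X] [AddCommGroup M] [Module ℝ M]
    [FiniteDimensional ℝ M] (φ : X →ₗ[ℝ] M) (V : Submodule ℝ X)
    (hV : ¬ FiniteDimensional ℝ V) : ¬ FiniteDimensional ℝ (V ⊓ LinearMap.ker φ : Submodule ℝ X) := by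
  intro h
  apply hV
  have h1 : (V.map φ).FG := IsNoetherian.noetherian _
  have h2 : (V ⊓ LinearMap.ker φ).FG := Module.Finite.iff_fg.mp h
  exact Module.Finite.iff_fg.mpr (Submodule.fg_of_fg_map_of_fg_inf_ker φ h1 h2)

lemma aux_small {X : Type*} [NormedAddCommGroup X] [NormedSpace ℝ X]
    (T : X →L[ℝ] X) (hT : StrictlySingular T) (V : Submodule ℝ X)
    (hV : ¬ FiniteDimensional ℝ V) (ε : ℝ) (hε : 0 < ε) :
    ∃ w ∈ V, ‖w‖ = 1 ∧ ‖T w‖ ≤ ε := by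
  by_contra! hcon
  have hinf : ¬ FiniteDimensional ℝ V.topologicalClosure := by
    intro h
    exact hV (Submodule.finiteDimensional_of_le V.le_topologicalClosure)
  apply hT V.topologicalClosure V.isClosed_topologicalClosure hinf
  refine ⟨ε, hε, ?_⟩
  have hcl : IsClosed {y : X | ε * ‖y‖ ≤ ‖T y‖} := isClosed_le (by fun_prop) (by fun_prop)
  have hsub : (V : Set X) ⊆ {y : X | ε * ‖y‖ ≤ ‖T y‖} := by
    intro y hy
    by_cases h0 : y = 0
    · simp [h0]
    have hn : 0 < ‖y‖ := norm_pos_iff.mpr h0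
    have := hcon (‖y‖⁻¹ • y) (V.smul_mem _ hy) (by rw [norm_smul]; simp; field_simp)
    rw [map_smul, norm_smul, norm_inv, norm_norm, inv_mul_eq_div, lt_div_iff₀ hn] at this
    exact this.le
  intro y hy
  exact closure_minimal hsub hcl hy

lemma aux_coef {X : Type*} [NormedAddCommGroup X] [NormedSpace ℝ X]
    (w : ℕ → X) (f : ℕ → (X →L[ℝ] ℝ)) (hf : ∀ n, ‖f n‖ ≤ 1) (hw : ∀ n, ‖w n‖ = 1)
    (hfw : ∀ n, f n (w n) = 1) (h0 : ∀ m n, m < n → f m (w n) = 0) (N : ℕ) (a : ℕ → ℝ)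
    (n : ℕ) (hn : n < N) :
    |a n| ≤ 2 ^ n * ‖∑ i ∈ Finset.range N, a i • w i‖ := by
  induction n using Nat.strong_induction_on with
  | _ n ih =>
    set v := ∑ i ∈ Finset.range N, a i • w i with hv
    have e : f n v = ∑ i ∈ Finset.range n, a i * f n (w i) + a n := by
      rw [hv, map_sum]
      simp only [map_smul, smul_eq_mul]
      have hs : Finset.range (n+1) ⊆ Finset.range N := by
        intro x; simp; omega
      rw [← Finset.sum_subset hs, Finset.sum_range_succ, hfw, mul_one]
      intro x _ hx
      rw [h0 n x (by simp at hx; omega), mul_zero]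
    have hb : ∀ x i, |f i x| ≤ ‖x‖ := by
      intro x i
      have := (f i).le_of_opNorm_le (hf i) x
      simpa using this
    have h1 : |∑ i ∈ Finset.range n, a i * f n (w i)| ≤ ∑ i ∈ Finset.range n, 2 ^ i * ‖v‖ := by
      refine (Finset.abs_sum_le_sum_abs _ _).trans (Finset.sum_le_sum fun i hi => ?_)
      have hi' := Finset.mem_range.mp hi
      rw [abs_mul]
      have := ih i hi' (by omega)
      have h2 := hb (w i) n
      rw [hw] at h2
      calc |a i| * |f n (w i)| ≤ |a i| * 1 := by gcongr
        _ ≤ _ := by simpa using this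
    rw [← Finset.sum_mul, geom_sum_eq (by norm_num)] at h1
    have h3 : a n = f n v - ∑ i ∈ Finset.range n, a i * f n (w i) := by rw [e]; ring
    rw [h3]
    refine (abs_sub _ _).trans ?_
    have := hb v n
    have : ((2:ℝ)^n - 1)/(2-1) = 2^n - 1 := by norm_num
    rw [this] at h1
    nlinarith

lemma aux_step {X : Type*} [NormedAddCommGroup X] [NormedSpace ℝ X]
    (T : X →L[ℝ] X) (hT : StrictlySingular T) (V : Submodule ℝ X)
    (hV : ¬ FiniteDimensional ℝ V) (η : ℝ) (hη : 0 < η) :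
    ∃ W : Submodule ℝ X, W ≤ V ∧ ¬ FiniteDimensional ℝ W ∧ ∀ w ∈ W, ‖T w‖ ≤ η * ‖w‖ := by
  classical
  obtain ⟨p, hP, hr⟩ := exists_seq_of_forall_finset_exists
    (α := ℕ × X × (X →L[ℝ] ℝ))
    (fun p => p.2.1 ∈ V ∧ ‖p.2.1‖ = 1 ∧ ‖T p.2.1‖ ≤ η / 4 ^ (p.1 + 1) ∧ ‖p.2.2‖ ≤ 1 ∧
      p.2.2 p.2.1 = 1)
    (fun p q => p.1 < q.1 ∧ p.2.2 q.2.1 = 0) (by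
      intro s _
      let φ : X →ₗ[ℝ] (s → ℝ) := LinearMap.pi fun i => (i.1.2.2 : X →ₗ[ℝ] ℝ)
      obtain ⟨w, hw, hw1, hw2⟩ := aux_small T hT _ (aux_inter φ V hV)
        (η / 4 ^ ((s.sup Prod.fst + 1) + 1)) (by positivity)
      obtain ⟨g, hg, hgw⟩ := exists_dual_vector ℝ w (by intro h; simp [h] at hw1)
      refine ⟨⟨s.sup Prod.fst + 1, w, g⟩, ⟨hw.1, hw1, hw2, hg.le, by simp [hgw, hw1]⟩, ?_⟩
      intro x hx
      refine ⟨Nat.lt_succ_of_le (Finset.le_sup (f := Prod.fst) hx), ?_⟩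
      have := hw.2
      exact congrFun (LinearMap.mem_ker.mp this) ⟨x, hx⟩)
  set w : ℕ → X := fun n => (p n).2.1 with hwdef
  have hmono : StrictMono (fun n => (p n).1) := fun m n h => (hr m n h).1
  have hc := aux_coef w (fun n => (p n).2.2) (fun n => (hP n).2.2.2.1) (fun n => (hP n).2.1)
    (fun n => (hP n).2.2.2.2) (fun m n h => (hr m n h).2)
  have hli : LinearIndependent ℝ w := by
    rw [linearIndependent_iff']
    intro s a hs i hi
    obtain ⟨N, hN⟩ := s.exists_nat_subset_range
    have := hc N (fun j => if j ∈ s then a j else 0) i (Finset.mem_range.mp (hN hi))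
    have e : ∑ j ∈ Finset.range N, (if j ∈ s then a j else 0) • w j = 0 := by
      rw [← hs, ← Finset.sum_subset hN]
      · exact Finset.sum_congr rfl fun j hj => by simp [hj]
      · intro j _ hj; simp [hj]
    rw [e] at this
    simpa [hi] using this
  refine ⟨Submodule.span ℝ (Set.range w), ?_, ?_, ?_⟩
  · rw [Submodule.span_le]
    rintro _ ⟨n, rfl⟩
    exact (hP n).1
  · intro h
    have := Module.Finite.finite_basis (Module.Basis.span hli)
    exact not_finite ℕ
  · intro v hv
    obtain ⟨l, rfl⟩ := (Finsupp.mem_span_range_iff_exists_finsupp).mp hv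
    obtain ⟨N, hN⟩ := l.support.exists_nat_subset_range
    have e : l.sum (fun i a => a • w i) = ∑ i ∈ Finset.range N, l i • w i :=
      Finsupp.sum_of_support_subset _ hN _ (by simp)
    rw [e, map_sum]
    set v := ∑ i ∈ Finset.range N, l i • w i with hv
    have hb : ∀ i ∈ Finset.range N, ‖T (l i • w i)‖ ≤ (η * ‖v‖ / 4) * (1/2)^i := by
      intro i hi
      rw [map_smul, norm_smul, Real.norm_eq_abs]
      have h1 := hc N l i (Finset.mem_range.mp hi)
      have h2 : ‖T (w i)‖ ≤ η / 4 ^ (i+1) := by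
        refine (hP i).2.2.1.trans ?_
        have : i ≤ (p i).1 := hmono.le_apply
        gcongr
        norm_num
      calc |l i| * ‖T (w i)‖ ≤ (2^i * ‖v‖) * (η / 4 ^ (i+1)) := by gcongr
        _ = _ := by
          have : (4:ℝ)^i = 2^i * 2^i := by rw [← mul_pow]; norm_num
          rw [pow_succ, this, one_div, inv_pow]
          field_simp
    refine (norm_sum_le _ _).trans ((Finset.sum_le_sum hb).trans ?_)
    rw [← Finset.mul_sum]
    have h2 : ∑ i ∈ Finset.range N, ((1:ℝ)/2)^i ≤ 2 := sum_geometric_two_le N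
    have h3 : 0 ≤ η * ‖v‖ := by positivity
    nlinarith

lemma aux_iter {X : Type*} [NormedAddCommGroup X] [NormedSpace ℝ X]
    (T : X →L[ℝ] X) (hT : StrictlySingular T) (hinj : Function.Injective T) (V : Submodule ℝ X)
    (hV : ¬ FiniteDimensional ℝ V) (η : ℝ) (hη : 0 < η) (n : ℕ) :
    ∃ W : Submodule ℝ X, W ≤ V ∧ ¬ FiniteDimensional ℝ W ∧
      ∀ w ∈ W, ∀ i < n, ‖(T ^ (i+1)) w‖ ≤ η * ‖(T ^ i) w‖ := by
  induction n with
  | zero => exact ⟨V, le_rfl, hV, by simp⟩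
  | succ n ih =>
    obtain ⟨W, hWV, hW, h⟩ := ih
    have hinj' : Function.Injective (T ^ n) := by
      rw [FunLike.coe_pow_eq_iterate]
      exact hinj.iterate n
    let S : X →ₗ[ℝ] X := (T ^ n : X →L[ℝ] X)
    have hS : Function.Injective S := hinj'
    have hmap : ¬ FiniteDimensional ℝ (W.map S) := by
      intro h
      exact hW (Module.Finite.equiv (W.equivMapOfInjective S hS).symm)
    obtain ⟨U, hU, hUi, hUT⟩ := aux_step T hT _ hmap η hη
    have hUmap : (U.comap S).map S = U := by
      rw [Submodule.map_comap_eq, inf_eq_right]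
      exact hU.trans (LinearMap.map_le_range)
    refine ⟨U.comap S, ?_, ?_, ?_⟩
    · refine (?_ : U.comap S ≤ W).trans hWV
      rw [← Submodule.comap_map_eq_of_injective hS W]
      exact Submodule.comap_mono hU
    · intro h
      apply hUi
      rw [← hUmap]
      infer_instance
    · intro w hw i hi
      rcases Nat.lt_succ_iff_lt_or_eq.mp hi with hi | rfl
      · refine h w ?_ i hi
        rw [← Submodule.comap_map_eq_of_injective hS W]
        exact Submodule.comap_mono hU hw
      · rw [pow_succ']
        exact hUT _ hw

theorem stmt_3 {X : Type*} [NormedAddCommGroup X] [NormedSpace ℝ X] [CompleteSpace X]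
    (hX : ¬ FiniteDimensional ℝ X) (T : X →L[ℝ] X)
    (hT : StrictlySingular T) (hinj : Function.Injective T)
    (k : ℕ) (hk : 0 < k) (η : ℝ) (hη : 0 < η)
    (F : Submodule ℝ X) (hFc : IsClosed (F : Set X)) (hF : FiniteDimensional ℝ (X ⧸ F))
    (Y : Submodule ℝ X) (hYc : IsClosed (Y : Set X)) (hY : ¬ FiniteDimensional ℝ Y) :
    ∃ Z : Submodule ℝ X, Z ≤ Y ∧ IsClosed (Z : Set X) ∧ ¬ FiniteDimensional ℝ Z ∧
      ∀ z ∈ Z, ∀ i, 1 ≤ i → i ≤ k + 1 →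
        (T ^ (i - 1)) z ∈ F ∧ ‖(T ^ i) z‖ ≤ η * ‖(T ^ (i - 1)) z‖ := by
  let φ : X →ₗ[ℝ] (Fin (k+1) → X ⧸ F) :=
    LinearMap.pi fun i => F.mkQ ∘ₗ ((T ^ (i : ℕ) : X →L[ℝ] X) : X →ₗ[ℝ] X)
  obtain ⟨W, hWV, hW, h⟩ := aux_iter T hT hinj _ (aux_inter φ Y hY) η hη (k+1)
  refine ⟨W.topologicalClosure, W.topologicalClosure_minimal (hWV.trans inf_le_left) hYc,
    W.isClosed_topologicalClosure, ?_, ?_⟩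
  · intro h
    exact hW (Submodule.finiteDimensional_of_le W.le_topologicalClosure)
  · intro z hz i hi1 hik
    obtain ⟨j, rfl⟩ : ∃ j, i = j + 1 := ⟨i - 1, by omega⟩
    simp only [Nat.add_sub_cancel]
    have hcl : IsClosed {z : X | (T ^ j) z ∈ F ∧ ‖(T ^ (j+1)) z‖ ≤ η * ‖(T ^ j) z‖} := by
      refine IsClosed.and (hFc.preimage (T ^ j).continuous) (isClosed_le ?_ ?_)
      · exact (T ^ (j+1)).continuous.norm
      · exact continuous_const.mul (T ^ j).continuous.norm
    refine closure_minimal (fun w hw => ?_) hcl hz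
    refine ⟨?_, h w hw j (by omega)⟩
    have h1 := congrFun (LinearMap.mem_ker.mp (hWV hw).2) ⟨j, by omega⟩
    exact (Submodule.Quotient.mk_eq_zero F).mp h1
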